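/- Let μ* be the acceptor-optimal stable matching of a two-sided matching market and let A_j be any acceptor. Then every sequence of the acceptor best-response dynamics starting from the near-stable matching μ*_{−A_j} terminates at μ* itself. -/

import Mathlib

open scoped ENNReal Classical

noncomputable section

/-- A two-sided matching market: proposers `P`, acceptors `A`, and injective
utility functions with values in `[0,1)` assigning `0` to being unmatched. -/
structure Market (P A : Type) where
  uP : P → Option A → ℝ
  uA : A → Option P → ℝ
  uP_inj : ∀ i, Function.Injective (uP i)
  uA_inj : ∀ j, Function.Injective (uA j)
  uP_mem : ∀ i o, uP i o ∈ Set.Ico (0 : ℝ) 1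
  uA_mem : ∀ j o, uA j o ∈ Set.Ico (0 : ℝ) 1
  uP_none : ∀ i, uP i none = 0
  uA_none : ∀ j, uA j none = 0

/-- A (pre-)matching / action profile: each proposer points to an optional acceptor and
each acceptor points to an optional proposer. -/
abbrev Profile (P A : Type) := (P → Option A) × (A → Option P)

variable {P A : Type}

/-- The partner of proposer `i` in the matching induced by the action profile `a`
(reciprocated choices only). -/
def matchedP (a : Profile P A) (i : P) : Option A :=
  match a.1 i with
  | some j => if a.2 j = some i then some j else none
  | none => none

/-- The partner of acceptor `j` in the matching induced by the action profile `a`. -/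
def matchedA (a : Profile P A) (j : A) : Option P :=
  match a.2 j with
  | some i => if a.1 i = some j then some i else none
  | none => none

/-- The matching induced by an action profile. -/
def induced (a : Profile P A) : Profile P A := (matchedP a, matchedA a)

/-- A profile is a genuine matching when the two partner functions are mutually consistent. -/
def Consistent (μ : Profile P A) : Prop := ∀ i j, μ.1 i = some j ↔ μ.2 j = some i

/-- `(i, j)` is a blocking pair for the matching `μ`. -/
def Blocking (M : Market P A) (μ : Profile P A) (i : P) (j : A) : Prop :=
  M.uP i (μ.1 i) < M.uP i (some j) ∧ M.uA j (μ.2 j) < M.uA j (some i)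

/-- A matching is stable when it admits no blocking pair. -/
def Stable (M : Market P A) (μ : Profile P A) : Prop := ∀ i j, ¬ Blocking M μ i j

/-- Utility received by proposer `i` under the action profile `a`. -/
def utilP (M : Market P A) (a : Profile P A) (i : P) : ℝ := M.uP i (matchedP a i)

/-- Utility received by acceptor `j` under the action profile `a`. -/
def utilA (M : Market P A) (a : Profile P A) (j : A) : ℝ := M.uA j (matchedA a j)

/-- The set of proposers proposing to acceptor `j` under proposer actions `ap`. -/
def proposals [Fintype P] (ap : P → Option A) (j : A) : Finset P :=
  Finset.univ.filter fun i => ap i = some j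

/-- `μ'` is obtained from `μ` by resolving the blocking pair `(i, j)`: `i` and `j`
become matched with one another and their previous partners, if any, become unmatched. -/
def ResolvedFrom (μ : Profile P A) (i : P) (j : A) (μ' : Profile P A) : Prop :=
  μ'.1 i = some j ∧ μ'.2 j = some i ∧
  (∀ i', i' ≠ i → μ'.1 i' = if μ.1 i' = some j then none else μ.1 i') ∧
  (∀ j', j' ≠ j → μ'.2 j' = if μ.2 j' = some i then none else μ.2 j')

/-- One round of the acceptor best-response dynamics: a blocking pair `(i, j)` is
resolved, where blocking pairs with a matched acceptor have priority over those with an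
unmatched acceptor, and the resolving acceptor resolves the blocking pair yielding it the
highest utility among its own blocking pairs. -/
def ABRDStep (M : Market P A) (μ μ' : Profile P A) : Prop :=
  ∃ i j, Blocking M μ i j ∧
    ((∃ i' j', Blocking M μ i' j' ∧ μ.2 j' ≠ none) → μ.2 j ≠ none) ∧
    (∀ i', Blocking M μ i' j → M.uA j (some i') ≤ M.uA j (some i)) ∧
    ResolvedFrom μ i j μ'

/-- The near-stable matching `μ_{-j}` obtained from `μ` by making acceptor `j` and its
partner unmatched. -/
def nearStableOf (μ : Profile P A) (j : A) : Profile P A :=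
  (fun i => if μ.2 j = some i then none else μ.1 i,
   fun j' => if j' = j then none else μ.2 j')

lemma Market.uP_none_lt (M : Market P A) (i : P) (j : A) : M.uP i none < M.uP i (some j) := by
  have h : M.uP i none ≠ M.uP i (some j) := (M.uP_inj i).ne (by simp)
  rw [M.uP_none] at h ⊢
  exact lt_of_le_of_ne (M.uP_mem i _).1 h

lemma Market.uA_none_lt (M : Market P A) (j : A) (i : P) : M.uA j none < M.uA j (some i) := by
  have h : M.uA j none ≠ M.uA j (some i) := (M.uA_inj j).ne (by simp)
  rw [M.uA_none] at h ⊢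
  exact lt_of_le_of_ne (M.uA_mem j _).1 h

lemma Consistent.resolvedFrom {μ μ' : Profile P A} {i : P} {j : A} (h : Consistent μ)
    (hr : ResolvedFrom μ i j μ') : Consistent μ' := by
  obtain ⟨h1, h2, h3, h4⟩ := hr
  intro p a
  have hpa := h p a
  by_cases hp : p = i <;> by_cases ha : a = j
  · subst hp ha
    simp [h1, h2]
  · subst hp
    rw [h1, h4 a ha]
    constructor
    · intro e
      exact absurd (Option.some.inj e).symm ha
    · split_ifs with h5 <;> simp [h5]
  · subst ha
    rw [h2, h3 p hp]
    constructor
    · split_ifs with h5 <;> simp [h5]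
    · intro e
      exact absurd (Option.some.inj e).symm hp
  · rw [h3 p hp, h4 a ha]
    split_ifs with h5 h6 h6
    · simp
    · simp only [false_iff]
      rw [← hpa, h5]
      exact fun e => ha (Option.some.inj e).symm
    · simp only [iff_false]
      rw [hpa, h6]
      exact fun e => hp (Option.some.inj e).symm
    · exact hpa

lemma Consistent.nearStableOf {μ : Profile P A} (h : Consistent μ) (j : A) :
    Consistent (nearStableOf μ j) := by
  intro p a
  have hpa := h p a
  have hpj := h p j
  simp only [_root_.nearStableOf]
  split_ifs with h1 h2 h2
  · simp
  · have : μ.1 p = some j := hpj.2 h1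
    simp only [false_iff]
    rw [← hpa, this]
    exact fun e => h2 (Option.some.inj e).symm
  · subst h2
    simp [hpa, h1]
  · exact hpa

lemma Consistent.eq_of_snd_eq {μ ν : Profile P A} (hμ : Consistent μ) (hν : Consistent ν)
    (h : μ.2 = ν.2) : μ = ν := by
  refine Prod.ext (funext fun p => Option.ext fun a => ?_) h
  rw [hμ p a, hν p a, h]

lemma exists_resolvedFrom (μ : Profile P A) (i : P) (j : A) : ∃ μ', ResolvedFrom μ i j μ' := by
  refine ⟨(fun p => if p = i then some j else if μ.1 p = some j then none else μ.1 p,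
    fun a => if a = j then some i else if μ.2 a = some i then none else μ.2 a), ?_, ?_, ?_, ?_⟩
  · simp
  · simp
  · intro p hp
    simp [hp]
  · intro a ha
    simp [ha]

lemma stable_of_forall_not_ABRDStep [Finite P] {M : Market P A} {μ : Profile P A}
    (h : ∀ ν, ¬ ABRDStep M μ ν) : Stable M μ := by
  intro i₀ j₀ hb₀
  obtain ⟨i₁, j, hb, hprio⟩ : ∃ i j, Blocking M μ i j ∧
      ((∃ i' j', Blocking M μ i' j' ∧ μ.2 j' ≠ none) → μ.2 j ≠ none) := by
    by_cases hm : ∃ i' j', Blocking M μ i' j' ∧ μ.2 j' ≠ none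
    · obtain ⟨i', j', hb', hn⟩ := hm
      exact ⟨i', j', hb', fun _ => hn⟩
    · exact ⟨i₀, j₀, hb₀, fun h => absurd h hm⟩
  obtain ⟨i, hi, hmax⟩ := Set.exists_max_image {i | Blocking M μ i j} (fun i => M.uA j (some i))
    (Set.toFinite _) ⟨i₁, hb⟩
  obtain ⟨ν, hν⟩ := exists_resolvedFrom μ i j
  exact h ν ⟨i, j, hi, hprio, hmax, hν⟩

/-- Every acceptor matched by `μ` gets at least its utility under `ν`. -/
def MatchedAtLeast (M : Market P A) (ν μ : Profile P A) : Prop :=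
  ∀ a, μ.2 a = none ∨ M.uA a (ν.2 a) ≤ M.uA a (μ.2 a)

lemma MatchedAtLeast.nearStableOf (M : Market P A) (μ : Profile P A) (j : A) :
    MatchedAtLeast M μ (nearStableOf μ j) := by
  intro a
  by_cases ha : a = j <;> simp [_root_.nearStableOf, ha]

lemma MatchedAtLeast.blocking {M : Market P A} {ν μ : Profile P A} (h : MatchedAtLeast M ν μ)
    (hν : Consistent ν) (hs : Stable M ν) (hμ : Consistent μ) {p : P} {a : A}
    (ha : μ.2 a = none) (hp : ν.2 a = some p) : Blocking M μ p a := by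
  refine ⟨?_, ha ▸ M.uA_none_lt a p⟩
  cases hb : μ.1 p with
  | none => exact M.uP_none_lt p a
  | some b =>
    have hbp := (hμ p b).1 hb
    have hba : b ≠ a := by
      rintro rfl
      simp [ha] at hbp
    have hpa := (hν p a).2 hp
    refine lt_of_le_of_ne ?_ ((M.uP_inj p).ne (by simpa using hba))
    by_contra! hlt
    have hle : M.uA b (ν.2 b) ≤ M.uA b (some p) := by
      simpa [hbp] using h b
    refine hs p b ⟨hpa ▸ hlt, lt_of_le_of_ne hle ((M.uA_inj b).ne fun e => hba ?_)⟩
    have := (hν p b).2 e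
    rw [hpa] at this
    exact (Option.some.inj this).symm

lemma MatchedAtLeast.step {M : Market P A} {ν μ μ' : Profile P A} (h : MatchedAtLeast M ν μ)
    (hν : Consistent ν) (hs : Stable M ν) (hμ : Consistent μ) (hstep : ABRDStep M μ μ') :
    MatchedAtLeast M ν μ' := by
  obtain ⟨i, j, hb, -, hbest, -, h2, -, h4⟩ := hstep
  intro a
  by_cases ha : a = j
  · subst ha
    right
    rw [h2]
    rcases h a with hn | hle
    · cases hp : ν.2 a with
      | none => exact (M.uA_none_lt a i).le
      | some p => exact hbest p (h.blocking hν hs hμ hn hp)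
    · exact hle.trans hb.2.le
  · rw [h4 a ha]
    split_ifs
    · exact Or.inl rfl
    · exact h a

/-- The blocking pairs of `μ` all have an unmatched acceptor. -/
def NoMatchedBlocking (M : Market P A) (μ : Profile P A) : Prop :=
  ∀ i j, Blocking M μ i j → μ.2 j = none

lemma ResolvedFrom.uP_le {M : Market P A} {μ μ' : Profile P A} {i : P} {j : A}
    (hr : ResolvedFrom μ i j μ') (hb : Blocking M μ i j) (hμ : Consistent μ)
    (hj : μ.2 j = none) (p : P) : M.uP p (μ.1 p) ≤ M.uP p (μ'.1 p) := by
  by_cases hp : p = i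
  · subst hp
    rw [hr.1]
    exact hb.1.le
  · have : μ.1 p ≠ some j := by simp [hμ p j, hj]
    rw [hr.2.2.1 p hp, if_neg this]

lemma NoMatchedBlocking.step {M : Market P A} {μ μ' : Profile P A} (h : NoMatchedBlocking M μ)
    (hμ : Consistent μ) (hstep : ABRDStep M μ μ') : NoMatchedBlocking M μ' := by
  obtain ⟨i, j, hb, -, hbest, hr⟩ := hstep
  have hj := h i j hb
  intro p a hpa
  have hlt := (hr.uP_le hb hμ hj p).trans_lt hpa.1
  have hu := hpa.2
  by_cases ha : a = j
  · subst ha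
    rw [hr.2.1] at hu
    exact absurd (hbest p ⟨hlt, hj ▸ M.uA_none_lt a p⟩) hu.not_ge
  · rw [hr.2.2.2 a ha] at hu ⊢
    split_ifs at hu ⊢
    · rfl
    · exact h p a ⟨hlt, hu⟩

lemma NoMatchedBlocking.sum_uP_lt [Fintype P] {M : Market P A} {μ μ' : Profile P A}
    (h : NoMatchedBlocking M μ) (hμ : Consistent μ) (hstep : ABRDStep M μ μ') :
    ∑ p, M.uP p (μ.1 p) < ∑ p, M.uP p (μ'.1 p) := by
  obtain ⟨i, j, hb, -, -, hr⟩ := hstep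
  refine Finset.sum_lt_sum (fun p _ => hr.uP_le hb hμ (h i j hb) p) ⟨i, Finset.mem_univ i, ?_⟩
  rw [hr.1]
  exact hb.1

/-- The utility of an acceptor, with being unmatched valued above every partner. -/
def unmatchedTopUtility (M : Market P A) (a : A) (o : Option P) : ℝ :=
  if o = none then 1 else M.uA a o

lemma sum_unmatchedTopUtility_lt [Fintype A] {M : Market P A} {μ μ' : Profile P A}
    (h : ¬ NoMatchedBlocking M μ) (hstep : ABRDStep M μ μ') :
    ∑ a, unmatchedTopUtility M a (μ.2 a) < ∑ a, unmatchedTopUtility M a (μ'.2 a) := by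
  obtain ⟨i, j, hb, hprio, -, -, h2, -, h4⟩ := hstep
  have hj : μ.2 j ≠ none := hprio (by simpa [NoMatchedBlocking] using h)
  have hlt : unmatchedTopUtility M j (μ.2 j) < unmatchedTopUtility M j (μ'.2 j) := by
    simpa [unmatchedTopUtility, hj, h2] using hb.2
  refine Finset.sum_lt_sum (fun a _ => ?_) ⟨j, Finset.mem_univ j, hlt⟩
  by_cases ha : a = j
  · exact ha ▸ hlt.le
  · rw [h4 a ha]
    split_ifs with h5
    · simpa [unmatchedTopUtility, h5] using (M.uA_mem a (some i)).2.le
    · exact le_rfl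

lemma not_forall_lt_succ_of_finite {α : Type*} [Finite α] (Φ : α → ℝ) (f : ℕ → α) :
    ¬ ∀ n, Φ (f n) < Φ (f (n + 1)) := by
  intro h
  have hinj : Function.Injective (Φ ∘ f) := (strictMono_nat_of_lt_succ h).injective
  exact not_injective_infinite_finite f hinj.of_comp

/-- Acceptor best-response dynamics terminates from every matching. -/
lemma not_forall_ABRDStep [Fintype P] [Fintype A] (M : Market P A) (f : ℕ → Profile P A)
    (h0 : Consistent (f 0)) : ¬ ∀ n, ABRDStep M (f n) (f (n + 1)) := by
  intro hstep
  have hc : ∀ n, Consistent (f n) := by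
    intro n
    induction n with
    | zero => exact h0
    | succ n ih =>
      obtain ⟨i, j, -, -, -, hr⟩ := hstep n
      exact ih.resolvedFrom hr
  by_cases hN : ∃ N, NoMatchedBlocking M (f N)
  · obtain ⟨N, hN⟩ := hN
    have hall : ∀ n, NoMatchedBlocking M (f (N + n)) := by
      intro n
      induction n with
      | zero => exact hN
      | succ n ih => exact ih.step (hc _) (hstep _)
    exact not_forall_lt_succ_of_finite (fun μ : Profile P A => ∑ p, M.uP p (μ.1 p))
      (fun n => f (N + n)) fun n => (hall n).sum_uP_lt (hc _) (hstep (N + n))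
  · push Not at hN
    exact not_forall_lt_succ_of_finite
      (fun μ : Profile P A => ∑ a, unmatchedTopUtility M a (μ.2 a)) f
      fun n => sum_unmatchedTopUtility_lt (hN n) (hstep n)

/-- If `μ*` is the acceptor-optimal stable matching and `A_j` any
acceptor, every sequence of the acceptor best-response dynamics starting from the
near-stable matching `μ*_{-A_j}` is finite and terminates at `μ*` itself. -/
theorem statement11 [Fintype P] [Fintype A] (M : Market P A)
    (μstar : Profile P A) (hcons : Consistent μstar) (hstab : Stable M μstar)
    (hopt : ∀ μ : Profile P A, Consistent μ → Stable M μ →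
      ∀ j, M.uA j (μ.2 j) ≤ M.uA j (μstar.2 j))
    (j : A) :
    (¬ ∃ f : ℕ → Profile P A, f 0 = nearStableOf μstar j ∧
      ∀ n, ABRDStep M (f n) (f (n + 1))) ∧
    (∀ (n : ℕ) (f : ℕ → Profile P A), f 0 = nearStableOf μstar j →
      (∀ i < n, ABRDStep M (f i) (f (i + 1))) →
      (∀ ν, ¬ ABRDStep M (f n) ν) → f n = μstar) := by
  refine ⟨fun ⟨f, h0, hstep⟩ => not_forall_ABRDStep M f (h0 ▸ hcons.nearStableOf j) hstep, ?_⟩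
  intro n f h0 hstep hend
  have hinv : ∀ k ≤ n, Consistent (f k) ∧ MatchedAtLeast M μstar (f k) := by
    intro k
    induction k with
    | zero =>
      intro _
      rw [h0]
      exact ⟨hcons.nearStableOf j, MatchedAtLeast.nearStableOf M μstar j⟩
    | succ k ih =>
      intro hk
      obtain ⟨hc, hm⟩ := ih (by omega)
      have hs := hstep k (by omega)
      refine ⟨?_, hm.step hcons hstab hc hs⟩
      obtain ⟨i, a, -, -, -, hr⟩ := hs
      exact hc.resolvedFrom hr
  obtain ⟨hc, hm⟩ := hinv n le_rfl
  have hs : Stable M (f n) := stable_of_forall_not_ABRDStep hend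
  refine hc.eq_of_snd_eq hcons (funext fun a => ?_)
  rcases hm a with hn | hle
  · cases hp : μstar.2 a with
    | none => rw [hn]
    | some p => exact absurd (hm.blocking hcons hstab hc hn hp) (hs p a)
  · exact M.uA_inj a (le_antisymm (hopt (f n) hc hs a) hle)

end
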